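/- arXiv:1610.06371 — 3 statements merged into one kernel-verified Lean document; each statement's English description precedes it below -/
import Mathlib

section
/- Let (S, ι, Pr) be a DTMC over a countable state set S and let μ be its trajectory measure on S^ℕ. For every finite nonempty path π = ⟨s₀, s₁, …, s_n⟩ over S, the measure of its cylinder equals its path probability: μ(Cyl(π)) = ι(s₀) · ∏_{i=0}^{n-1} Pr(s_i, s_{i+1}). -/
open MeasureTheory

/-- A discrete-time Markov chain over a (countable) state set `S`:
an initial distribution `init` summing to `1` and a transition probability
`tr` with `∑_{s'} tr s s' = 1` for every `s`. -/
structure DTMC (S : Type*) where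
  init : S → ℝ
  tr : S → S → ℝ
  init_nonneg : ∀ s, 0 ≤ init s
  init_le_one : ∀ s, init s ≤ 1
  init_hasSum : HasSum init 1
  tr_nonneg : ∀ s s', 0 ≤ tr s s'
  tr_le_one : ∀ s s', tr s s' ≤ 1
  tr_hasSum : ∀ s, HasSum (tr s) 1

/-- The path probability `P(⟨s₀,…,s_n⟩) = init s₀ * ∏_{i=0}^{n-1} tr s_i s_{i+1}`
of a finite path in a DTMC. -/
noncomputable def pathProb {S : Type*} (D : DTMC S) (π : List S) : ℝ :=
  match π with
  | [] => 0
  | s :: rest => D.init s * (((s :: rest).zip rest).map fun p => D.tr p.1 p.2).prod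

/-- The cylinder of a finite nonempty path `π` over `S`. -/
def cylinder {S : Type*} (π : List S) : Set (ℕ → S) :=
  {ω | ∀ i, (hi : i < π.length) → ω i = π.get ⟨i, hi⟩}

open MeasureTheory ProbabilityTheory

namespace CylAux

/-- The set of sequences agreeing with a given one up to time `n`. -/
def agree {S : Type*} (w : ℕ → S) (n : ℕ) : Set (ℕ → S) := {x | ∀ i ≤ n, x i = w i}

lemma agree_eq {S : Type*} (w : ℕ → S) (n : ℕ) :
    agree w n = (Preorder.frestrictLe (π := fun _ => S) n) ⁻¹' {Preorder.frestrictLe n w} := by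
  ext x
  simp only [agree, Set.mem_ofPred_eq, Set.mem_preimage, Set.mem_singleton_iff, funext_iff]
  constructor
  · intro h i
    exact h i (Finset.mem_Iic.1 i.2)
  · intro h i hi
    exact h ⟨i, Finset.mem_Iic.2 hi⟩

lemma list_prod {S : Type*} (f : S → S → ℝ) (d : S) (rest : List S) (s : S) :
    (((s :: rest).zip rest).map fun p => f p.1 p.2).prod =
      ∏ i ∈ Finset.range rest.length,
        f ((s :: rest).getD i d) ((s :: rest).getD (i + 1) d) := by
  induction rest generalizing s with
  | nil => simp
  | cons a l ih =>
    rw [List.zip_cons_cons, List.map_cons, List.prod_cons, ih a, List.length_cons,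
      Finset.prod_range_succ']
    simp [mul_comm]

lemma cylinder_eq {S : Type*} (d s : S) (rest : List S) :
    cylinder (s :: rest) = agree (fun i => (s :: rest).getD i d) rest.length := by
  ext x
  simp only [_root_.cylinder, agree, Set.mem_ofPred_eq]
  constructor
  · intro h i hi
    have h2 : i < (s :: rest).length := by simp; omega
    rw [h i h2, List.getD_eq_getElem _ _ h2]; rfl
  · intro h i hi
    have h2 : i ≤ rest.length := by simp at hi; omega
    rw [h i h2, List.getD_eq_getElem _ _ hi]; rfl

/-- Probability of the first `n` steps. -/
noncomputable def pp {S : Type*} (D : DTMC S) (w : ℕ → S) (n : ℕ) : ℝ :=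
  D.init (w 0) * ∏ i ∈ Finset.range n, D.tr (w i) (w (i + 1))

lemma pathProb_eq {S : Type*} (D : DTMC S) (d s : S) (rest : List S) :
    pathProb D (s :: rest) = pp D (fun i => (s :: rest).getD i d) rest.length := by
  simp only [pathProb, pp]
  rw [list_prod D.tr d]
  simp

/-- Every `agree` set is a cylinder. -/
lemma agree_list {S : Type*} (w : ℕ → S) (n : ℕ) :
    ∃ π : List S, π ≠ [] ∧ cylinder π = agree w n := by
  refine ⟨List.ofFn (fun i : Fin (n + 1) => w i), by simp, ?_⟩
  ext x
  simp only [_root_.cylinder, agree, Set.mem_ofPred_eq, List.length_ofFn, List.get_ofFn, Nat.lt_succ_iff]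
  rfl

noncomputable def toPMF {S : Type*} (f : S → ℝ) (h0 : ∀ s, 0 ≤ f s) (h : HasSum f 1) : PMF S :=
  ⟨fun s => ENNReal.ofReal (f s), by
    have := ENNReal.ofReal_tsum_of_nonneg h0 h.summable
    rw [h.tsum_eq, ENNReal.ofReal_one] at this
    rw [this]
    exact ENNReal.summable.hasSum⟩

section
variable {S : Type*} [Countable S] [MeasurableSpace S] [DiscreteMeasurableSpace S] (D : DTMC S)

noncomputable def mu0 : Measure S := (toPMF D.init D.init_nonneg D.init_hasSum).toMeasure

instance : IsProbabilityMeasure (mu0 D) := by unfold mu0; infer_instance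

noncomputable def ker (n : ℕ) : Kernel ((i : Finset.Iic n) → (fun _ : ℕ => S) i) S where
  toFun x := (toPMF (D.tr (x ⟨n, Finset.mem_Iic.2 le_rfl⟩)) (D.tr_nonneg _) (D.tr_hasSum _)).toMeasure
  measurable' := measurable_from_top.comp (g := fun s : S =>
    (toPMF (D.tr s) (D.tr_nonneg _) (D.tr_hasSum _)).toMeasure) (by
      have : (⊤ : MeasurableSpace S) = ‹MeasurableSpace S› := by
        ext s; simp [MeasurableSet.of_discrete]
      rw [this]
      exact measurable_pi_apply _)

instance (n : ℕ) : IsMarkovKernel (ker D n) := ⟨fun x => by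
  change IsProbabilityMeasure (PMF.toMeasure _); infer_instance⟩

noncomputable def mu : Measure (ℕ → S) :=
  Kernel.trajMeasure (X := fun _ => S) (mu0 D) (ker D)

instance : IsProbabilityMeasure (mu D) := by unfold mu; infer_instance

lemma mu_agree (w : ℕ → S) (n : ℕ) : mu D (agree w n) = ENNReal.ofReal (pp D w n) := by
  induction n with
  | zero =>
    rw [agree_eq, ← Measure.map_apply (by fun_prop) (.singleton _), mu, Kernel.trajMeasure,
      Measure.map_comp _ _ (by fun_prop), Kernel.traj_map_frestrictLe, Kernel.partialTraj_self,
      Measure.id_comp, Measure.map_apply (by fun_prop) (.singleton _)]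
    have : (MeasurableEquiv.piUnique (fun i : Finset.Iic 0 => (fun _ : ℕ => S) i)).symm ⁻¹'
        {Preorder.frestrictLe 0 w} = {w 0} := by
      ext s
      simp only [Set.mem_preimage, Set.mem_singleton_iff]
      rw [MeasurableEquiv.symm_apply_eq]
      rfl
    erw [this]
    rw [mu0, PMF.toMeasure_apply_singleton _ _ (.singleton _)]
    simp [pp, toPMF]
    rfl
  | succ n ih =>
    have h1 : agree w (n + 1) = (fun x : ℕ → S => (Preorder.frestrictLe (π := fun _ => S) n x, x (n + 1))) ⁻¹'
        ({Preorder.frestrictLe n w} ×ˢ {w (n + 1)}) := by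
      ext x
      have := Set.ext_iff.1 (agree_eq w n) x
      simp only [Set.mem_preimage, Set.mem_prod, Set.mem_singleton_iff] at this ⊢
      rw [← this]
      simp only [agree, Set.mem_ofPred_eq]
      constructor
      · intro h
        exact ⟨fun i hi => h i (by omega), h _ le_rfl⟩
      · rintro ⟨h, h'⟩ i hi
        rcases Nat.le_succ_iff.1 hi with hi | rfl
        · exact h i hi
        · exact h'
    have h2 := Kernel.map_frestrictLe_trajMeasure_compProd_eq_map_trajMeasure
      (X := fun _ => S) (μ₀ := mu0 D) (κ := ker D) (a := n)
    rw [agree_eq, ← Measure.map_apply (by fun_prop) (.singleton _)] at ih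
    rw [h1, ← Measure.map_apply (by fun_prop) ((MeasurableSet.singleton _).prod (.singleton _)), mu, ← h2,
      Measure.compProd_apply_prod (.singleton _) (.singleton _), lintegral_singleton]
    change _ * Measure.map _ (mu D) _ = _
    rw [ih]
    have h3 : ker D n (Preorder.frestrictLe n w) {w (n+1)} = ENNReal.ofReal (D.tr (w n) (w (n+1))) := by
      change PMF.toMeasure _ _ = _
      rw [PMF.toMeasure_apply_singleton _ _ (.singleton _)]
      rfl
    rw [h3, ← ENNReal.ofReal_mul (D.tr_nonneg _ _), pp, pp, Finset.prod_range_succ]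
    congr 1
    ring

lemma uniq {μ ν : Measure (ℕ → S)} [IsProbabilityMeasure μ]
    [IsProbabilityMeasure ν] (h : ∀ w n, μ (agree w n) = ν (agree w n)) : μ = ν := by
  have key : ∀ n, μ.map (Preorder.frestrictLe (π := fun _ => S) n)
      = ν.map (Preorder.frestrictLe (π := fun _ => S) n) := by
    intro n
    apply Measure.ext_of_singleton
    intro a
    rw [Measure.map_apply (by fun_prop) (.singleton _),
      Measure.map_apply (by fun_prop) (.singleton _)]
    let w : ℕ → S := fun i => if hi : i ≤ n then a ⟨i, Finset.mem_Iic.2 hi⟩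
      else a ⟨n, Finset.mem_Iic.2 le_rfl⟩
    have hw : Preorder.frestrictLe (π := fun _ => S) n w = a := by
      ext i
      have := Finset.mem_Iic.1 i.2
      simp [w, this]
    rw [← hw, ← agree_eq]
    exact h w n
  have hP : ∀ I : Finset ℕ, μ.map (I.restrict (π := fun _ => S)) = ν.map (I.restrict (π := fun _ => S)) := by
    intro I
    have hI := I.subset_Iic_sup_id
    rw [← Finset.restrict₂_comp_restrict hI, ← Measure.map_map (by fun_prop) (by fun_prop),
      ← Measure.map_map (by fun_prop) (by fun_prop)]
    congr 1
    exact key _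
  have : ∀ I : Finset ℕ, IsFiniteMeasure (ν.map (I.restrict (π := fun _ => S))) :=
    fun I => inferInstance
  exact IsProjectiveLimit.unique (α := fun _ : ℕ => S) (P := fun I : Finset ℕ => ν.map (I.restrict (π := fun _ => S)))
    hP (fun I => rfl)

end
end CylAux

/-- The trajectory measure of a DTMC over a countable state set (the unique
probability measure on `S^ℕ` obtained by the Ionescu–Tulcea construction)
assigns to the cylinder of every finite nonempty path its path probability:
there is exactly one probability measure on `S^ℕ` with
`μ(Cyl(π)) = P(π)` for all finite nonempty paths `π`. -/
theorem trajectoryMeasure_cylinder {S : Type*} [Countable S] [Nonempty S]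
    [MeasurableSpace S] [DiscreteMeasurableSpace S] (D : DTMC S) :
    ∃! μ : Measure (ℕ → S), IsProbabilityMeasure μ ∧
      ∀ π : List S, π ≠ [] → μ (cylinder π) = ENNReal.ofReal (pathProb D π) := by
  obtain ⟨d⟩ := ‹Nonempty S›
  refine ⟨CylAux.mu D, ⟨inferInstance, ?_⟩, ?_⟩
  · intro π hπ
    cases π with
    | nil => exact absurd rfl hπ
    | cons s rest =>
      rw [CylAux.cylinder_eq d, CylAux.pathProb_eq D d, CylAux.mu_agree]
  · rintro ν ⟨hν, h⟩
    apply CylAux.uniq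
    intro w n
    obtain ⟨π, hπ, e⟩ := CylAux.agree_list w n
    rw [← e, h π hπ]
    cases π with
    | nil => exact absurd rfl hπ
    | cons s rest =>
      rw [CylAux.cylinder_eq d, CylAux.pathProb_eq D d, CylAux.mu_agree]
end

section
/- Let (S, ι, Pr) be a DTMC over a countable state set S with trajectory measure μ, let B ⊆ S be a set of states, and let r ∈ [0,1]. Suppose C is a countable set of finite nonempty paths over S such that: (i) no element of C is a proper prefix of another element of C, (ii) every path in C ends in a state of B, and (iii) ∑_{π ∈ C} P(π) > r, where P(π) is the path probability. Then μ({ω ∈ S^ℕ | ∃ n, ω(n) ∈ B}) > r; that is, the DTMC does not satisfy the property P_{≤ r}(F B) that the probability of eventually reaching B is at most r. -/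
open MeasureTheory

theorem pathProb_nonneg_aux {S : Type*} (D : DTMC S) (π : List S) : 0 ≤ pathProb D π := by
  cases π with
  | nil => simp [pathProb]
  | cons s rest =>
    refine mul_nonneg (D.init_nonneg s) (List.prod_nonneg ?_)
    intro a ha
    obtain ⟨p, _, rfl⟩ := List.mem_map.1 ha
    exact D.tr_nonneg _ _

theorem cylinder_measurable_aux {S : Type*} [MeasurableSpace S] [DiscreteMeasurableSpace S]
    (π : List S) : MeasurableSet (cylinder π) := by
  have : cylinder π = ⋂ i : Fin π.length, (fun ω : ℕ → S => ω i) ⁻¹' {π.get i} := by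
    ext ω
    simp only [_root_.cylinder, Set.mem_ofPred_eq, Set.mem_iInter, Set.mem_preimage, Set.mem_singleton_iff]
    exact ⟨fun h i => h i.1 i.2, fun h i hi => h ⟨i, hi⟩⟩
  rw [this]
  exact MeasurableSet.iInter fun i => measurable_pi_apply _ (MeasurableSet.of_discrete)

theorem cylinder_prefix_aux {S : Type*} (π₁ π₂ : List S) (ω : ℕ → S) (h₁ : ω ∈ cylinder π₁)
    (h₂ : ω ∈ cylinder π₂) (hl : π₁.length ≤ π₂.length) : π₁ <+: π₂ := by
  rw [List.prefix_iff_eq_take]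
  apply List.ext_getElem
  · simp [hl]
  · intro i hi hi'
    have a := h₁ i hi
    have b := h₂ i (by omega)
    simp only [List.get_eq_getElem] at a b
    rw [List.getElem_take, ← a, ← b]

/-- If `C` is a countable prefix-free set of finite nonempty paths, all ending
in `B`, whose accumulated path probability exceeds `r`, then the probability
that the DTMC eventually reaches `B` exceeds `r`; i.e. the DTMC violates
`P_{≤ r}(F B)`.  Here `μ` is the trajectory measure of the DTMC, characterized
by assigning to every cylinder its path probability. -/
theorem counterexample_refutes_safety {S : Type*} [Countable S] [Nonempty S]
    [MeasurableSpace S] [DiscreteMeasurableSpace S] (D : DTMC S)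
    (μ : Measure (ℕ → S)) [IsProbabilityMeasure μ]
    (hμ : ∀ π : List S, π ≠ [] → μ (cylinder π) = ENNReal.ofReal (pathProb D π))
    (B : Set S) (r : ℝ) (hr0 : 0 ≤ r) (hr1 : r ≤ 1)
    (C : Set (List S)) (hCc : C.Countable)
    (hne : ∀ π ∈ C, π ≠ [])
    (hpf : ∀ π₁ ∈ C, ∀ π₂ ∈ C, π₁ <+: π₂ → π₁ = π₂)
    (hB : ∀ π ∈ C, ∀ hπ : π ≠ [], π.getLast hπ ∈ B)
    (hsum : r < ∑' π : C, pathProb D (π : List S)) :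
    ENNReal.ofReal r < μ {ω | ∃ n, ω n ∈ B} := by
  have hs : Summable fun π : C => pathProb D (π : List S) := by
    by_contra h
    rw [tsum_eq_zero_of_not_summable h] at hsum
    linarith
  have : Countable C := hCc.to_subtype
  have hd : Pairwise (Function.onFun Disjoint fun π : C => cylinder (π : List S)) := by
    intro a b hab
    refine Set.disjoint_left.2 fun ω h₁ h₂ => hab (Subtype.ext ?_)
    rcases le_total a.1.length b.1.length with h | h
    · exact hpf _ a.2 _ b.2 (cylinder_prefix_aux _ _ ω h₁ h₂ h)
    · exact (hpf _ b.2 _ a.2 (cylinder_prefix_aux _ _ ω h₂ h₁ h)).symm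
  calc ENNReal.ofReal r < ENNReal.ofReal (∑' π : C, pathProb D (π : List S)) :=
        (ENNReal.ofReal_lt_ofReal_iff_of_nonneg hr0).2 hsum
    _ = ∑' π : C, μ (cylinder (π : List S)) := by
        rw [ENNReal.ofReal_tsum_of_nonneg (fun π => pathProb_nonneg_aux D _) hs]
        exact tsum_congr fun π => (hμ _ (hne _ π.2)).symm
    _ = μ (⋃ π : C, cylinder (π : List S)) :=
        (measure_iUnion hd fun π => cylinder_measurable_aux _).symm
    _ ≤ μ {ω | ∃ n, ω n ∈ B} := by
        refine measure_mono (Set.iUnion_subset fun π ω hω => ?_)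
        have hn := hne _ π.2
        have hl := List.length_pos_iff.2 hn
        refine ⟨π.1.length - 1, ?_⟩
        rw [hω (π.1.length - 1) (by omega)]
        have := hB _ π.2 hn
        rwa [List.getLast_eq_getElem] at this
end

section
/- Let (S, ι, Pr) be a DTMC over a countable state set S with trajectory measure μ, and let B ⊆ S. Call a finite path ⟨s₀, s₁, …, s_n⟩ a first-hitting path for B if s_n ∈ B and s_i ∉ B for all 0 ≤ i < n. Then the probability of eventually reaching B equals the (countable) sum of the path probabilities of all first-hitting paths for B: μ({ω ∈ S^ℕ | ∃ n, ω(n) ∈ B}) = ∑_{π first-hitting path for B} P(π), where P(⟨s₀,…,s_n⟩) = ι(s₀) · ∏_{i=0}^{n-1} Pr(s_i, s_{i+1}). -/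
open MeasureTheory

/-- A finite path `⟨s₀,…,s_n⟩` is a first-hitting path for `B` if `s_n ∈ B`
and `s_i ∉ B` for all `0 ≤ i < n`. -/
def IsFirstHittingPath {S : Type*} (B : Set S) (π : List S) : Prop :=
  ∃ hπ : π ≠ [], π.getLast hπ ∈ B ∧
    ∀ i, (hi : i < π.length - 1) → π.get ⟨i, by omega⟩ ∉ B

lemma aux_meas {S : Type*} [MeasurableSpace S] [DiscreteMeasurableSpace S] (π : List S) :
    MeasurableSet (_root_.cylinder π) := by
  have : _root_.cylinder π = ⋂ i, ⋂ hi : i < π.length,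
      (fun ω : ℕ → S => ω i) ⁻¹' {π.get ⟨i, hi⟩} := by
    ext ω; simp [_root_.cylinder]
  rw [this]
  exact MeasurableSet.iInter fun i => MeasurableSet.iInter fun hi =>
    measurable_pi_apply i (MeasurableSet.of_discrete)

lemma aux_len {S : Type*} {B : Set S} {π ρ : List S} (h : IsFirstHittingPath B π)
    (h' : IsFirstHittingPath B ρ) {ω : ℕ → S} (hω : ω ∈ _root_.cylinder π)
    (hω' : ω ∈ _root_.cylinder ρ) : π.length ≤ ρ.length := by
  obtain ⟨h0, h1, h2⟩ := h
  obtain ⟨h0', h1', h2'⟩ := h'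
  by_contra hlt
  have p := List.length_pos_of_ne_nil h0'
  have e1 := hω (ρ.length - 1) (by omega)
  have e2 := hω' (ρ.length - 1) (by omega)
  apply h2 (ρ.length - 1) (by omega)
  rw [← e1, e2]
  rw [List.getLast_eq_getElem] at h1'
  exact h1'

lemma aux_eq {S : Type*} {B : Set S} {π ρ : List S} (h : IsFirstHittingPath B π)
    (h' : IsFirstHittingPath B ρ) {ω : ℕ → S} (hω : ω ∈ _root_.cylinder π)
    (hω' : ω ∈ _root_.cylinder ρ) : π = ρ := by
  have hl := le_antisymm (aux_len h h' hω hω') (aux_len h' h hω' hω)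
  refine List.ext_get hl fun n h1 h2 => ?_
  rw [← hω n h1, ← hω' n h2]

lemma aux_union {S : Type*} (B : Set S) : {ω : ℕ → S | ∃ n, ω n ∈ B} =
    ⋃ π : {π : List S // IsFirstHittingPath B π}, _root_.cylinder (π : List S) := by
  classical
  ext ω
  simp only [Set.mem_ofPred_eq, Set.mem_iUnion]
  constructor
  · intro h
    refine ⟨⟨List.ofFn (fun i : Fin (Nat.find h + 1) => ω i), ?_, ?_, ?_⟩, ?_⟩
    · simp
    · rw [List.getLast_eq_getElem]
      simpa [-List.ofFn_succ] using Nat.find_spec h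
    · intro i hi
      simp only [List.length_ofFn] at hi
      simpa [-List.ofFn_succ] using Nat.find_min h (m := i) (by omega)
    · intro i hi
      simp [-List.ofFn_succ]
  · rintro ⟨⟨π, h0, h1, h2⟩, hω⟩
    have p := List.length_pos_of_ne_nil h0
    refine ⟨π.length - 1, ?_⟩
    have e : ω (π.length - 1) = π.get ⟨π.length - 1, by omega⟩ :=
      hω (π.length - 1) (Nat.sub_lt p one_pos)
    rw [e]
    rw [List.getLast_eq_getElem] at h1
    exact h1

/-- The probability of eventually reaching `B` equals the countable sum of the
path probabilities of all first-hitting paths for `B`.  Here `μ` is the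
trajectory measure of the DTMC, characterized by assigning to every cylinder
its path probability. -/
theorem reach_prob_eq_sum_firstHitting {S : Type*} [Countable S] [Nonempty S]
    [MeasurableSpace S] [DiscreteMeasurableSpace S] (D : DTMC S)
    (μ : Measure (ℕ → S)) [IsProbabilityMeasure μ]
    (hμ : ∀ π : List S, π ≠ [] → μ (cylinder π) = ENNReal.ofReal (pathProb D π))
    (B : Set S) :
    μ {ω | ∃ n, ω n ∈ B} =
      ∑' π : {π : List S // IsFirstHittingPath B π},
        ENNReal.ofReal (pathProb D (π : List S)) := by
  rw [aux_union B, measure_iUnion _ fun π => aux_meas _]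
  · exact tsum_congr fun π => hμ _ π.2.1
  · intro π ρ hne
    refine Set.disjoint_left.2 fun ω h h' => hne ?_
    exact Subtype.ext (aux_eq π.2 ρ.2 h h')
end
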